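/- arXiv:math/0602023 — 2 statements merged into one kernel-verified Lean document; each statement's English description precedes it below -/
import Mathlib

section
/- Let p, q, r be pairwise relatively prime positive integers and let a, b, c be integers with aqr + bpr + cpq = 1. Let π be the group with presentation ⟨x, y, z, h | h x h⁻¹ x⁻¹ = 1, h y h⁻¹ y⁻¹ = 1, h z h⁻¹ z⁻¹ = 1, x^p = h^a, y^q = h^b, z^r = h^c, xyz = 1⟩ (the fundamental group of the Brieskorn homology sphere Σ(p,q,r)). Then for every irreducible representation ρ : π → SL₂(ℂ), the first group cohomology H¹(π; sl₂(ℂ)_{Ad ρ}) vanishes. -/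
abbrev SL2C := Matrix.SpecialLinearGroup (Fin 2) ℂ

/-- A representation `ρ : G → SL₂(ℂ)` is irreducible if the matrices `ρ g` have no
common eigenvector, i.e. there is no one-dimensional invariant subspace of `ℂ²`. -/
def IsIrreducibleRep {G : Type} [Group G] (ρ : G →* SL2C) : Prop :=
  ¬ ∃ v : Fin 2 → ℂ, v ≠ 0 ∧ ∀ g : G, ∃ c : ℂ,
    Matrix.mulVec (ρ g : Matrix (Fin 2) (Fin 2) ℂ) v = c • v

/-- The space `Z¹(G; sl₂(ℂ)_{Ad ρ})` of 1-cocycles: maps `u : G → sl₂(ℂ)` with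
`u (g h) = u g + ρ(g) u(h) ρ(g)⁻¹`, as a subspace of maps into trace-zero matrices. -/
noncomputable def cocycleSpace {G : Type} [Group G] (ρ : G →* SL2C) :
    Submodule ℂ (G → Matrix (Fin 2) (Fin 2) ℂ) where
  carrier := {u | (∀ g, Matrix.trace (u g) = 0) ∧
    ∀ g h : G, u (g * h) = u g +
      (ρ g : Matrix (Fin 2) (Fin 2) ℂ) * u h * (((ρ g)⁻¹ : SL2C) : Matrix (Fin 2) (Fin 2) ℂ)}
  add_mem' := by
    rintro u v ⟨hu1, hu2⟩ ⟨hv1, hv2⟩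
    refine ⟨fun g => by simp [hu1 g, hv1 g], fun g h => ?_⟩
    simp only [Pi.add_apply, hu2 g h, hv2 g h, mul_add, add_mul]
    abel
  zero_mem' := ⟨by simp, by simp⟩
  smul_mem' := by
    rintro c u ⟨hu1, hu2⟩
    refine ⟨fun g => by simp [hu1 g], fun g h => ?_⟩
    simp only [Pi.smul_apply, hu2 g h, smul_add, mul_smul_comm, smul_mul_assoc]

/-- The relations of the presentation
`⟨x, y, z, h ∣ h central, x^p = h^a, y^q = h^b, z^r = h^c, xyz = 1⟩` of the fundamental
group of the Brieskorn sphere `Σ(p,q,r)`; generators `x, y, z, h` are `0, 1, 2, 3`. -/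
def brieskornRels (p q r : ℕ) (a b c : ℤ) : Set (FreeGroup (Fin 4)) :=
  {FreeGroup.of 3 * FreeGroup.of 0 * (FreeGroup.of 3)⁻¹ * (FreeGroup.of 0)⁻¹,
   FreeGroup.of 3 * FreeGroup.of 1 * (FreeGroup.of 3)⁻¹ * (FreeGroup.of 1)⁻¹,
   FreeGroup.of 3 * FreeGroup.of 2 * (FreeGroup.of 3)⁻¹ * (FreeGroup.of 2)⁻¹,
   FreeGroup.of 0 ^ p * ((FreeGroup.of 3) ^ a)⁻¹,
   FreeGroup.of 1 ^ q * ((FreeGroup.of 3) ^ b)⁻¹,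
   FreeGroup.of 2 ^ r * ((FreeGroup.of 3) ^ c)⁻¹,
   FreeGroup.of 0 * FreeGroup.of 1 * FreeGroup.of 2}


open Matrix in
/-- Schur's lemma: a matrix commuting with an irreducible representation is scalar. -/
theorem IsIrreducibleRep.exists_eq_smul_one {G : Type} [Group G] {ρ : G →* SL2C}
    (hρ : IsIrreducibleRep ρ) (M : Matrix (Fin 2) (Fin 2) ℂ)
    (hM : ∀ g, M * (ρ g : Matrix (Fin 2) (Fin 2) ℂ) = ρ g * M) :
    ∃ t : ℂ, M = t • (1 : Matrix (Fin 2) (Fin 2) ℂ) := by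
  obtain ⟨μ, hμ⟩ := Module.End.exists_eigenvalue (Matrix.toLin' M)
  obtain ⟨v, hv⟩ := hμ.exists_hasEigenvector
  have hv0 : v ≠ 0 := hv.2
  have hMv : M *ᵥ v = μ • v := by simpa using hv.apply_eq_smul
  refine ⟨μ, ?_⟩
  by_contra hne
  refine hρ ⟨v, hv0, fun g => ?_⟩
  set w := (ρ g : Matrix (Fin 2) (Fin 2) ℂ) *ᵥ v with hw
  have hMw : M *ᵥ w = μ • w := by
    rw [hw, mulVec_mulVec, hM, ← mulVec_mulVec, hMv, mulVec_smul]
  have hdet : v 0 * w 1 - v 1 * w 0 = 0 := by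
    by_contra hd
    apply hne
    have e0 := congrFun hMv 0
    have e1 := congrFun hMv 1
    have f0 := congrFun hMw 0
    have f1 := congrFun hMw 1
    simp only [mulVec, dotProduct, Fin.sum_univ_two, Pi.smul_apply, smul_eq_mul]
      at e0 e1 f0 f1
    ext i j
    fin_cases i <;> fin_cases j <;> simp <;> apply mul_right_cancel₀ hd
    · linear_combination w 1 * e0 - v 1 * f0
    · linear_combination v 0 * f0 - w 0 * e0
    · linear_combination w 1 * e1 - v 1 * f1
    · linear_combination v 0 * f1 - w 0 * e1
  by_cases h0 : v 0 = 0
  · have h1 : v 1 ≠ 0 := fun h1 => hv0 (by ext i; fin_cases i <;> simp [h0, h1])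
    refine ⟨w 1 / v 1, ?_⟩
    ext i
    fin_cases i <;> simp <;> field_simp
    linear_combination -hdet
  · refine ⟨w 0 / v 0, ?_⟩
    ext i
    fin_cases i <;> simp <;> field_simp
    linear_combination hdet

/-- A trace-free matrix orthogonal to a nonzero commutator `[A, B]` under the trace form lies in
the span of `1`, `A` and `B`. -/
theorem exists_eq_add_of_trace_mul_commutator_eq_zero {A B Y : Matrix (Fin 2) (Fin 2) ℂ}
    (hAB : A * B ≠ B * A) (hY : Y.trace = 0) (h : (Y * (B * A - A * B)).trace = 0) :
    ∃ s t k : ℂ, Y = s • A + t • B + k • 1 := by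
  have hY' : Y 1 1 = - Y 0 0 := by
    rw [Matrix.trace_fin_two] at hY
    linear_combination hY
  simp only [Matrix.trace_fin_two, Matrix.mul_apply, Matrix.sub_apply, Fin.sum_univ_two, hY'] at h
  -- the coordinates of the cross product of the trace-free parts of `A` and `B`
  by_cases c1 : A 0 1 * B 1 0 - A 1 0 * B 0 1 = 0
  · by_cases c2 : (A 0 0 - A 1 1) * B 0 1 - A 0 1 * (B 0 0 - B 1 1) = 0
    · by_cases c3 : (A 0 0 - A 1 1) * B 1 0 - A 1 0 * (B 0 0 - B 1 1) = 0
      · refine absurd ?_ hAB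
        ext i j
        fin_cases i <;> fin_cases j <;> simp [Matrix.mul_apply]
        · linear_combination c1
        · linear_combination c2
        · linear_combination -c3
        · linear_combination -c1
      · set D := (A 0 0 - A 1 1) * B 1 0 - A 1 0 * (B 0 0 - B 1 1)
        set s := (2 * Y 0 0 * B 1 0 - Y 1 0 * (B 0 0 - B 1 1)) / D with hs
        set t := ((A 0 0 - A 1 1) * Y 1 0 - A 1 0 * (2 * Y 0 0)) / D with ht
        refine ⟨s, t, Y 0 0 - s * A 0 0 - t * B 0 0, ?_⟩
        ext i j
        fin_cases i <;> fin_cases j <;> simp [hY'] <;> rw [hs, ht] <;> field_simp <;> grind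
    · set D := (A 0 0 - A 1 1) * B 0 1 - A 0 1 * (B 0 0 - B 1 1)
      set s := (2 * Y 0 0 * B 0 1 - Y 0 1 * (B 0 0 - B 1 1)) / D with hs
      set t := ((A 0 0 - A 1 1) * Y 0 1 - A 0 1 * (2 * Y 0 0)) / D with ht
      refine ⟨s, t, Y 0 0 - s * A 0 0 - t * B 0 0, ?_⟩
      ext i j
      fin_cases i <;> fin_cases j <;> simp [hY'] <;> rw [hs, ht] <;> field_simp <;> grind
  · set D := A 0 1 * B 1 0 - A 1 0 * B 0 1
    set s := (Y 0 1 * B 1 0 - Y 1 0 * B 0 1) / D with hs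
    set t := (A 0 1 * Y 1 0 - A 1 0 * Y 0 1) / D with ht
    refine ⟨s, t, Y 0 0 - s * A 0 0 - t * B 0 0, ?_⟩
    ext i j
    fin_cases i <;> fin_cases j <;> simp [hY'] <;> rw [hs, ht] <;> field_simp <;> grind

section Cocycle

variable {G : Type} [Group G] {ρ : G →* SL2C} {u : G → Matrix (Fin 2) (Fin 2) ℂ}

theorem coe_mul_coe_inv (g : G) :
    (ρ g : Matrix (Fin 2) (Fin 2) ℂ) * (((ρ g)⁻¹ : SL2C) : Matrix (Fin 2) (Fin 2) ℂ) = 1 := by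
  rw [← Matrix.SpecialLinearGroup.coe_mul, mul_inv_cancel, Matrix.SpecialLinearGroup.coe_one]

theorem coe_inv_mul_coe (g : G) :
    (((ρ g)⁻¹ : SL2C) : Matrix (Fin 2) (Fin 2) ℂ) * (ρ g : Matrix (Fin 2) (Fin 2) ℂ) = 1 := by
  rw [← Matrix.SpecialLinearGroup.coe_mul, inv_mul_cancel, Matrix.SpecialLinearGroup.coe_one]

theorem conj_eq_self_iff_commute (g : G) (X : Matrix (Fin 2) (Fin 2) ℂ) :
    (ρ g : Matrix (Fin 2) (Fin 2) ℂ) * X * (((ρ g)⁻¹ : SL2C) : Matrix (Fin 2) (Fin 2) ℂ) = X ↔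
      X * (ρ g : Matrix (Fin 2) (Fin 2) ℂ) = ρ g * X := by
  constructor
  · intro h
    conv_lhs => rw [← h]
    rw [mul_assoc, coe_inv_mul_coe, mul_one]
  · intro h
    rw [← h, mul_assoc, coe_mul_coe_inv, mul_one]

theorem coboundary_mem_cocycleSpace (X : Matrix (Fin 2) (Fin 2) ℂ) :
    (fun g => X - (ρ g : Matrix (Fin 2) (Fin 2) ℂ) * X *
      (((ρ g)⁻¹ : SL2C) : Matrix (Fin 2) (Fin 2) ℂ)) ∈ cocycleSpace ρ := by
  refine ⟨fun g => ?_, fun g k => ?_⟩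
  · rw [Matrix.trace_sub, Matrix.trace_mul_comm, ← mul_assoc, coe_inv_mul_coe, one_mul, sub_self]
  · simp only [map_mul, mul_inv_rev, Matrix.SpecialLinearGroup.coe_mul]
    noncomm_ring

/-- The subgroup of elements on which a cocycle vanishes. -/
def cocycleKernel (hu : u ∈ cocycleSpace ρ) : Subgroup G where
  carrier := {g | u g = 0}
  one_mem' := by simpa using hu.2 1 1
  mul_mem' := by
    intro g k hg hk
    simp only [Set.mem_ofPred_eq] at *
    rw [hu.2, hg, hk]
    simp
  inv_mem' := by
    intro g hg
    have h1 : u 1 = 0 := by simpa using hu.2 1 1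
    have h := hu.2 g⁻¹ g
    simp only [Set.mem_ofPred_eq] at *
    simpa [h1, hg] using h.symm

theorem mem_cocycleKernel (hu : u ∈ cocycleSpace ρ) (g : G) :
    g ∈ cocycleKernel hu ↔ u g = 0 := Iff.rfl

/-- A cocycle vanishing on a positive power of `g` restricts to a coboundary on `⟨g⟩`. -/
theorem exists_coboundary_of_pow_eq_zero (hu : u ∈ cocycleSpace ρ) (g : G) {n : ℕ} (hn : 0 < n)
    (h : u (g ^ n) = 0) :
    ∃ X : Matrix (Fin 2) (Fin 2) ℂ, X.trace = 0 ∧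
      u g = X - (ρ g : Matrix (Fin 2) (Fin 2) ℂ) * X *
        (((ρ g)⁻¹ : SL2C) : Matrix (Fin 2) (Fin 2) ℂ) := by
  have hn' : (n : ℂ) ≠ 0 := by exact_mod_cast hn.ne'
  have h1 : u 1 = 0 := by simpa using hu.2 1 1
  refine ⟨(n : ℂ)⁻¹ • ∑ i ∈ Finset.range n, u (g ^ i), ?_, ?_⟩
  · simp [Matrix.trace_smul, Matrix.trace_sum, hu.1]
  · have key : ∀ i, u (g ^ i) - (ρ g : Matrix (Fin 2) (Fin 2) ℂ) * u (g ^ i) *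
        (((ρ g)⁻¹ : SL2C) : Matrix (Fin 2) (Fin 2) ℂ) = u g - (u (g ^ (i + 1)) - u (g ^ i)) := by
      intro i
      rw [pow_succ', hu.2]
      abel
    rw [mul_smul_comm, smul_mul_assoc, ← smul_sub, Finset.mul_sum, Finset.sum_mul,
      ← Finset.sum_sub_distrib, Finset.sum_congr rfl (fun i _ => key i),
      Finset.sum_sub_distrib, Finset.sum_range_sub (fun i => u (g ^ i)), h, pow_zero, h1,
      Finset.sum_const, Finset.card_range, sub_self, sub_zero, ← Nat.cast_smul_eq_nsmul ℂ,
      smul_smul, inv_mul_cancel₀ hn', one_smul]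

/-- A cocycle that is a coboundary at `g` does not change the trace of `ρ g` to first order. -/
theorem trace_mul_eq_zero_of_coboundary {g : G} {X : Matrix (Fin 2) (Fin 2) ℂ}
    (h : u g = X - (ρ g : Matrix (Fin 2) (Fin 2) ℂ) * X *
        (((ρ g)⁻¹ : SL2C) : Matrix (Fin 2) (Fin 2) ℂ)) :
    (u g * (ρ g : Matrix (Fin 2) (Fin 2) ℂ)).trace = 0 := by
  rw [h, sub_mul, mul_assoc _ _ (ρ g : Matrix (Fin 2) (Fin 2) ℂ), coe_inv_mul_coe, mul_one,
    Matrix.trace_sub, Matrix.trace_mul_comm, sub_self]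

/-- If a cocycle is a coboundary on each of `⟨x⟩`, `⟨y⟩` and `⟨x y⟩`, and `ρ x`, `ρ y` do not
commute, then it agrees with a single coboundary on `x` and `y`. -/
theorem exists_coboundary_on_pair (hu : u ∈ cocycleSpace ρ) (x y : G)
    (hxy : (ρ x : Matrix (Fin 2) (Fin 2) ℂ) * (ρ y : Matrix (Fin 2) (Fin 2) ℂ) ≠ ρ y * ρ x)
    {X Y : Matrix (Fin 2) (Fin 2) ℂ} (hX0 : X.trace = 0) (hY0 : Y.trace = 0)
    (hX : u x = X - (ρ x : Matrix (Fin 2) (Fin 2) ℂ) * X *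
        (((ρ x)⁻¹ : SL2C) : Matrix (Fin 2) (Fin 2) ℂ))
    (hY : u y = Y - (ρ y : Matrix (Fin 2) (Fin 2) ℂ) * Y *
        (((ρ y)⁻¹ : SL2C) : Matrix (Fin 2) (Fin 2) ℂ))
    (hZ : (u (x * y) * (ρ (x * y) : Matrix (Fin 2) (Fin 2) ℂ)).trace = 0) :
    ∃ W : Matrix (Fin 2) (Fin 2) ℂ, W.trace = 0 ∧
      u x = W - (ρ x : Matrix (Fin 2) (Fin 2) ℂ) * W *
        (((ρ x)⁻¹ : SL2C) : Matrix (Fin 2) (Fin 2) ℂ) ∧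
      u y = W - (ρ y : Matrix (Fin 2) (Fin 2) ℂ) * W *
        (((ρ y)⁻¹ : SL2C) : Matrix (Fin 2) (Fin 2) ℂ) := by
  have hx := coe_inv_mul_coe (ρ := ρ) x
  have hx' := coe_mul_coe_inv (ρ := ρ) x
  have hy := coe_inv_mul_coe (ρ := ρ) y
  have hy' := coe_mul_coe_inv (ρ := ρ) y
  rw [hu.2, hX, hY, map_mul, Matrix.SpecialLinearGroup.coe_mul] at hZ
  rw [hX, hY]
  generalize (ρ x : Matrix (Fin 2) (Fin 2) ℂ) = A at *
  generalize (ρ y : Matrix (Fin 2) (Fin 2) ℂ) = B at *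
  generalize (((ρ x)⁻¹ : SL2C) : Matrix (Fin 2) (Fin 2) ℂ) = A' at *
  generalize (((ρ y)⁻¹ : SL2C) : Matrix (Fin 2) (Fin 2) ℂ) = B' at *
  have e : (X - A * X * A' + A * (Y - B * Y * B') * A') * (A * B) =
      X * (A * B) - A * (X * B) + A * (Y * B) - A * B * Y := by
    calc _ = X * (A * B) - A * X * (A' * A) * B + A * Y * (A' * A) * B
          - A * B * Y * (B' * (A' * A) * B) := by noncomm_ring
      _ = _ := by rw [hx, mul_one, mul_one, mul_one, hy, mul_one]; noncomm_ring
  have hYX : ((Y - X) * (B * A - A * B)).trace = 0 := by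
    rw [e, Matrix.trace_sub, Matrix.trace_add, Matrix.trace_sub, Matrix.trace_mul_comm A (X * B),
      Matrix.trace_mul_comm A (Y * B), Matrix.trace_mul_comm (A * B) Y] at hZ
    rw [sub_mul, mul_sub, mul_sub, Matrix.trace_sub, Matrix.trace_sub, Matrix.trace_sub]
    simp only [← mul_assoc] at hZ ⊢
    linear_combination hZ
  obtain ⟨s, t, k, hst⟩ := exists_eq_add_of_trace_mul_commutator_eq_zero hxy
    (by rw [Matrix.trace_sub, hX0, hY0, sub_zero]) hYX
  have hA : A * A * A' = A := by rw [mul_assoc, hx', mul_one]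
  have hB : B * B * B' = B := by rw [mul_assoc, hy', mul_one]
  refine ⟨X + s • A - (s * A.trace / 2) • 1, ?_, ?_, ?_⟩
  · simp [Matrix.trace_sub, Matrix.trace_add, hX0]
  · simp only [mul_sub, mul_add, sub_mul, add_mul, mul_smul_comm, smul_mul_assoc, mul_one, hx', hA]
    abel
  · have hW : X + s • A - (s * A.trace / 2) • 1 =
        Y - t • B - (k + s * A.trace / 2) • 1 := by
      rw [eq_add_of_sub_eq hst]
      module
    rw [hW]
    simp only [mul_sub, sub_mul, mul_smul_comm, smul_mul_assoc, mul_one, hy', hB]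
    abel

end Cocycle

section Brieskorn

variable {p q r : ℕ} {a b c : ℤ}

theorem brieskorn_mem_of_generators {K : Subgroup (PresentedGroup (brieskornRels p q r a b c))}
    (h0 : PresentedGroup.of 0 ∈ K) (h1 : PresentedGroup.of 1 ∈ K) (h3 : PresentedGroup.of 3 ∈ K)
    (g : PresentedGroup (brieskornRels p q r a b c)) : g ∈ K := by
  have h2 : PresentedGroup.of 2 ∈ K := by
    have h : (PresentedGroup.of 0 * PresentedGroup.of 1 * PresentedGroup.of 2 :
        PresentedGroup (brieskornRels p q r a b c)) = 1 :=
      PresentedGroup.one_of_mem (by simp [brieskornRels])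
    rw [← inv_eq_of_mul_eq_one_right h]
    exact K.inv_mem (K.mul_mem h0 h1)
  have hle : Subgroup.closure (Set.range PresentedGroup.of) ≤ K := by
    rw [Subgroup.closure_le]
    rintro _ ⟨i, rfl⟩
    fin_cases i <;> assumption
  exact hle (by rw [PresentedGroup.closure_range_of]; trivial)

theorem brieskorn_fiber_central (g : PresentedGroup (brieskornRels p q r a b c)) :
    PresentedGroup.of 3 * g = g * PresentedGroup.of 3 := by
  have hc : ∀ i : Fin 4, FreeGroup.of 3 * FreeGroup.of i * (FreeGroup.of 3)⁻¹ *
      (FreeGroup.of i)⁻¹ ∈ brieskornRels p q r a b c →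
      (PresentedGroup.of i : PresentedGroup (brieskornRels p q r a b c)) ∈
        Subgroup.centralizer {PresentedGroup.of 3} := by
    intro i hi
    have h : (PresentedGroup.of 3 * PresentedGroup.of i * (PresentedGroup.of 3)⁻¹ *
        (PresentedGroup.of i)⁻¹ : PresentedGroup (brieskornRels p q r a b c)) = 1 :=
      PresentedGroup.one_of_mem hi
    rw [Subgroup.mem_centralizer_singleton_iff]
    exact (mul_inv_eq_iff_eq_mul.mp (mul_inv_eq_one.mp h)).symm
  have h := brieskorn_mem_of_generators (hc 0 (by simp [brieskornRels]))
    (hc 1 (by simp [brieskornRels]))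
    (Subgroup.mem_centralizer_singleton_iff.mpr rfl) g
  exact (Subgroup.mem_centralizer_singleton_iff.mp h).symm

theorem brieskorn_commute_of_generators {ρ : PresentedGroup (brieskornRels p q r a b c) →* SL2C}
    {M : Matrix (Fin 2) (Fin 2) ℂ}
    (h0 : M * (ρ (.of 0) : Matrix (Fin 2) (Fin 2) ℂ) = ρ (.of 0) * M)
    (h1 : M * (ρ (.of 1) : Matrix (Fin 2) (Fin 2) ℂ) = ρ (.of 1) * M)
    (h3 : M * (ρ (.of 3) : Matrix (Fin 2) (Fin 2) ℂ) = ρ (.of 3) * M)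
    (g : PresentedGroup (brieskornRels p q r a b c)) :
    M * (ρ g : Matrix (Fin 2) (Fin 2) ℂ) = ρ g * M := by
  have hmem : ∀ g, g ∈ cocycleKernel (coboundary_mem_cocycleSpace (ρ := ρ) M) ↔
      M * (ρ g : Matrix (Fin 2) (Fin 2) ℂ) = ρ g * M := fun g => by
    rw [mem_cocycleKernel, sub_eq_zero, eq_comm, conj_eq_self_iff_commute]
  exact (hmem g).mp (brieskorn_mem_of_generators ((hmem _).mpr h0) ((hmem _).mpr h1)
    ((hmem _).mpr h3) g)

theorem brieskorn_fiber_commute {ρ : PresentedGroup (brieskornRels p q r a b c) →* SL2C}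
    (hρ : IsIrreducibleRep ρ) (M : Matrix (Fin 2) (Fin 2) ℂ) :
    M * (ρ (.of 3) : Matrix (Fin 2) (Fin 2) ℂ) = ρ (.of 3) * M := by
  obtain ⟨t, ht⟩ := hρ.exists_eq_smul_one (ρ (.of 3)) fun g => by
    rw [← Matrix.SpecialLinearGroup.coe_mul, ← map_mul, brieskorn_fiber_central, map_mul,
      Matrix.SpecialLinearGroup.coe_mul]
  rw [ht]
  simp

theorem brieskorn_not_commute {ρ : PresentedGroup (brieskornRels p q r a b c) →* SL2C}
    (hρ : IsIrreducibleRep ρ) :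
    (ρ (.of 0) : Matrix (Fin 2) (Fin 2) ℂ) * (ρ (.of 1) : Matrix (Fin 2) (Fin 2) ℂ) ≠
      ρ (.of 1) * ρ (.of 0) := by
  intro h
  obtain ⟨s, hs⟩ := hρ.exists_eq_smul_one _
    (brieskorn_commute_of_generators rfl h (brieskorn_fiber_commute hρ _))
  obtain ⟨t, ht⟩ := hρ.exists_eq_smul_one _
    (brieskorn_commute_of_generators h.symm rfl (brieskorn_fiber_commute hρ _))
  obtain ⟨k, hk⟩ := hρ.exists_eq_smul_one !![0, 1; 0, 0]
    (brieskorn_commute_of_generators (by rw [hs]; simp) (by rw [ht]; simp)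
      (brieskorn_fiber_commute hρ _))
  simpa using congrFun (congrFun hk 0) 1

theorem brieskorn_cocycle_fiber_eq_zero
    {ρ : PresentedGroup (brieskornRels p q r a b c) →* SL2C} (hρ : IsIrreducibleRep ρ)
    {u : PresentedGroup (brieskornRels p q r a b c) → Matrix (Fin 2) (Fin 2) ℂ}
    (hu : u ∈ cocycleSpace ρ) : u (.of 3) = 0 := by
  obtain ⟨t, ht⟩ := hρ.exists_eq_smul_one (u (.of 3)) fun g => by
    rw [← conj_eq_self_iff_commute]
    have h := congrArg u (brieskorn_fiber_central g)
    rw [hu.2, hu.2, (conj_eq_self_iff_commute _ _).mpr (brieskorn_fiber_commute hρ (u g)),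
      add_comm] at h
    exact (add_left_cancel h).symm
  have htr := hu.1 (.of 3)
  rw [ht] at htr ⊢
  simpa [Matrix.trace_smul] using htr

theorem brieskorn_exists_coboundary_on_cyclic
    {ρ : PresentedGroup (brieskornRels p q r a b c) →* SL2C} (hρ : IsIrreducibleRep ρ)
    {u : PresentedGroup (brieskornRels p q r a b c) → Matrix (Fin 2) (Fin 2) ℂ}
    (hu : u ∈ cocycleSpace ρ) (i : Fin 4) {n : ℕ} (hn : 0 < n) (m : ℤ)
    (hrel : FreeGroup.of i ^ n * (FreeGroup.of 3 ^ m)⁻¹ ∈ brieskornRels p q r a b c) :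
    ∃ X : Matrix (Fin 2) (Fin 2) ℂ, X.trace = 0 ∧
      u (.of i) = X - (ρ (.of i) : Matrix (Fin 2) (Fin 2) ℂ) * X *
        (((ρ (.of i))⁻¹ : SL2C) : Matrix (Fin 2) (Fin 2) ℂ) := by
  refine exists_coboundary_of_pow_eq_zero hu _ hn ?_
  have h : (PresentedGroup.of i ^ n * (PresentedGroup.of 3 ^ m)⁻¹ :
      PresentedGroup (brieskornRels p q r a b c)) = 1 := PresentedGroup.one_of_mem hrel
  rw [mul_inv_eq_one.mp h]
  exact (cocycleKernel hu).zpow_mem (brieskorn_cocycle_fiber_eq_zero hρ hu) m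

end Brieskorn

/-- For an irreducible `SL₂(ℂ)` representation of the fundamental group of the
Brieskorn sphere `Σ(p,q,r)`, the first group cohomology `H¹(π; sl₂(ℂ)_{Ad ρ})`
vanishes: every 1-cocycle is a 1-coboundary `g ↦ X - ρ(g) X ρ(g)⁻¹`. -/
theorem brieskorn_H1_vanishes (p q r : ℕ) (hp : 0 < p) (hq : 0 < q) (hr : 0 < r)
    (hpq : Nat.Coprime p q) (hpr : Nat.Coprime p r) (hqr : Nat.Coprime q r)
    (a b c : ℤ) (habc : a * q * r + b * p * r + c * p * q = 1)
    (ρ : PresentedGroup (brieskornRels p q r a b c) →* SL2C)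
    (hρ : IsIrreducibleRep ρ) :
    ∀ u ∈ cocycleSpace ρ, ∃ X : Matrix (Fin 2) (Fin 2) ℂ, Matrix.trace X = 0 ∧
      ∀ g : PresentedGroup (brieskornRels p q r a b c),
        u g = X - (ρ g : Matrix (Fin 2) (Fin 2) ℂ) * X *
          (((ρ g)⁻¹ : SL2C) : Matrix (Fin 2) (Fin 2) ℂ) := by
  intro u hu
  obtain ⟨X, hX0, hX⟩ := brieskorn_exists_coboundary_on_cyclic hρ hu 0 hp a
    (by simp [brieskornRels])
  obtain ⟨Y, hY0, hY⟩ := brieskorn_exists_coboundary_on_cyclic hρ hu 1 hq b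
    (by simp [brieskornRels])
  obtain ⟨Z, -, hZ⟩ := brieskorn_exists_coboundary_on_cyclic hρ hu 2 hr c
    (by simp [brieskornRels])
  have hxyz : (PresentedGroup.of 0 * PresentedGroup.of 1 * PresentedGroup.of 2 :
      PresentedGroup (brieskornRels p q r a b c)) = 1 :=
    PresentedGroup.one_of_mem (by simp [brieskornRels])
  have hsub {W : Matrix (Fin 2) (Fin 2) ℂ} :=
    (cocycleSpace ρ).sub_mem hu (coboundary_mem_cocycleSpace W)
  have hxy : u (.of 0 * .of 1) = Z - (ρ (.of 0 * .of 1) : Matrix (Fin 2) (Fin 2) ℂ) * Z *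
      (((ρ (.of 0 * .of 1))⁻¹ : SL2C) : Matrix (Fin 2) (Fin 2) ℂ) := by
    have h := (cocycleKernel (hsub (W := Z))).inv_mem (x := .of 2) (sub_eq_zero.mpr hZ)
    rw [← eq_inv_of_mul_eq_one_left hxyz] at h
    exact sub_eq_zero.mp h
  obtain ⟨W, hW0, hWx, hWy⟩ := exists_coboundary_on_pair hu (.of 0) (.of 1)
    (brieskorn_not_commute hρ) hX0 hY0 hX hY (trace_mul_eq_zero_of_coboundary hxy)
  refine ⟨W, hW0, fun g => sub_eq_zero.mp ?_⟩
  exact brieskorn_mem_of_generators (K := cocycleKernel (hsub (W := W)))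
    (sub_eq_zero.mpr hWx) (sub_eq_zero.mpr hWy)
    (brieskorn_cocycle_fiber_eq_zero hρ hsub) g
end

section
/- Let p, q, r be pairwise relatively prime positive integers with q and r odd, and let T(2p, q, r) be the triangle group with presentation ⟨x, y, z | x^{2p} = 1, y^q = 1, z^r = 1, xyz = 1⟩. Then the set of conjugacy classes of irreducible representations ρ : T(2p,q,r) → SL₂(ℂ) (under conjugation by elements of SL₂(ℂ)) is finite, of cardinality exactly (p−1)·((q−1)/2)·((r−1)/2). -/
/-- Conjugacy of irreducible representations: `ρ₂ = P ρ₁ P⁻¹` for some `P ∈ SL₂(ℂ)`. -/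
def ConjRel {G : Type} [Group G]
    (ρ₁ ρ₂ : {ρ : G →* SL2C // IsIrreducibleRep ρ}) : Prop :=
  ∃ P : SL2C, ∀ g : G, ρ₂.1 g = P * ρ₁.1 g * P⁻¹

/-- The relations of the triangle group presentation
`T(a,b,c) = ⟨x, y, z ∣ x^a = y^b = z^c = xyz = 1⟩`; generators `x, y, z` are `0, 1, 2`. -/
def triangleRels (a b c : ℕ) : Set (FreeGroup (Fin 3)) :=
  {FreeGroup.of 0 ^ a, FreeGroup.of 1 ^ b, FreeGroup.of 2 ^ c,
   FreeGroup.of 0 * FreeGroup.of 1 * FreeGroup.of 2}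

open Matrix

/-- The traces `ζ + ζ⁻¹` of the elements of `SL₂(ℂ)` of order dividing `n`
which are not `1` or `-1`. -/
def torsionTraces (n : ℕ) : Set ℂ := {t | ∃ ζ : ℂ, ζ ^ n = 1 ∧ ζ ^ 2 ≠ 1 ∧ t = ζ + ζ⁻¹}

lemma torsionTraces_eq_image {n : ℕ} (hn : 0 < n) :
    torsionTraces n =
      (fun k : ℕ => ((2 * Real.cos (2 * Real.pi * k / n) : ℝ) : ℂ)) ''
        (Finset.Icc 1 ((n - 1) / 2) : Set ℕ) := by
  have hn0 : (n : ℂ) ≠ 0 := by exact_mod_cast hn.ne'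
  have key : ∀ k : ℕ, ((2 * Real.cos (2 * Real.pi * k / n) : ℝ) : ℂ) =
      Complex.exp (2 * Real.pi * Complex.I * (k / n)) +
        (Complex.exp (2 * Real.pi * Complex.I * (k / n)))⁻¹ := by
    intro k
    push_cast
    rw [Complex.two_cos, ← Complex.exp_neg]
    congr 2 <;> ring
  ext t
  constructor
  · rintro ⟨ζ, h1, h2, rfl⟩
    have hζ : ζ ≠ 0 := by
      rintro rfl
      simp [hn.ne'] at h1
    have : NeZero n := ⟨hn.ne'⟩
    obtain ⟨k, hk, hkζ⟩ := (Complex.mem_rootsOfUnity n (Units.mk0 ζ hζ)).1 (by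
      rw [mem_rootsOfUnity]
      ext
      simpa using h1)
    rw [Units.val_mk0] at hkζ
    subst hkζ
    have hk0 : k ≠ 0 := by
      rintro rfl
      simp at h2
    have hk2 : 2 * k ≠ n := by
      intro h
      apply h2
      rw [← Complex.exp_nat_mul, Complex.exp_eq_one_iff]
      have h' : (n : ℂ) = 2 * k := by exact_mod_cast h.symm
      refine ⟨1, ?_⟩
      rw [← mul_div_assoc]
      push_cast
      field_simp
      linear_combination -h'
    rcases le_or_gt (2 * k) n with h | h
    · refine ⟨k, ?_, key k⟩
      simp only [Finset.coe_Icc, Set.mem_Icc]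
      omega
    · refine ⟨n - k, ?_, ?_⟩
      · simp only [Finset.coe_Icc, Set.mem_Icc]
        omega
      · rw [← key k]
        have hn1 : (n : ℝ) ≠ 0 := by exact_mod_cast hn.ne'
        have : 2 * Real.pi * (n - k : ℕ) / n = 2 * Real.pi - 2 * Real.pi * k / n := by
          rw [Nat.cast_sub hk.le]
          field_simp
        simp only [this, Real.cos_two_pi_sub]
  · rintro ⟨k, hk, rfl⟩
    simp only [Finset.coe_Icc, Set.mem_Icc] at hk
    refine ⟨_, ?_, ?_, key k⟩
    · rw [← Complex.exp_nat_mul, Complex.exp_eq_one_iff]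
      exact ⟨k, by push_cast; field_simp⟩
    · rw [← Complex.exp_nat_mul, Ne, Complex.exp_eq_one_iff]
      rintro ⟨m, hm⟩
      have h3 : (2 * k : ℂ) = m * n := by
        have := Complex.two_pi_I_ne_zero
        field_simp at hm
        push_cast at hm
        linear_combination hm
      have h4 : (2 * k : ℤ) = m * n := by exact_mod_cast h3
      have h5 : 2 * k < n := by omega
      have h6 : 0 < m := by
        by_contra! h
        nlinarith
      nlinarith

lemma ncard_torsionTraces {n : ℕ} (hn : 0 < n) :
    (torsionTraces n).Finite ∧ (torsionTraces n).ncard = (n - 1) / 2 := by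
  rw [torsionTraces_eq_image hn]
  refine ⟨(Finset.finite_toSet _).image _, ?_⟩
  rw [Set.InjOn.ncard_image, Set.ncard_coe_finset, Nat.card_Icc]
  · omega
  intro a ha b hb hab
  simp only [Finset.coe_Icc, Set.mem_Icc] at ha hb
  have hn' : (0 : ℝ) < n := by exact_mod_cast hn
  have mem : ∀ k : ℕ, k ≤ (n - 1) / 2 →
      2 * Real.pi * k / n ∈ Set.Icc 0 Real.pi := by
    intro k hk
    have : (2 * k : ℝ) ≤ n := by
      have : 2 * k ≤ n := by omega
      exact_mod_cast this
    refine ⟨by positivity, ?_⟩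
    rw [div_le_iff₀ hn']
    nlinarith [Real.pi_pos]
  have h1 : Real.cos (2 * Real.pi * a / n) = Real.cos (2 * Real.pi * b / n) := by
    have := Complex.ofReal_injective hab
    linarith
  have h2 := Real.injOn_cos (mem a ha.2) (mem b hb.2) h1
  have := Real.pi_pos
  field_simp at h2
  exact_mod_cast h2

lemma SL2C.val_one : (1 : SL2C).1 = 1 := rfl

lemma SL2C.val_mul (A B : SL2C) : (A * B).1 = A.1 * B.1 := rfl

lemma SL2C.val_pow (A : SL2C) (n : ℕ) : (A ^ n).1 = A.1 ^ n := Matrix.SpecialLinearGroup.coe_pow A n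

/-- The subgroup of `SL₂(ℂ)` fixing the line through `v`. -/
def lineStabilizer (v : Fin 2 → ℂ) (hv : v ≠ 0) : Subgroup SL2C where
  carrier := {g | ∃ c : ℂ, (g : Matrix (Fin 2) (Fin 2) ℂ) *ᵥ v = c • v}
  one_mem' := ⟨1, by simp⟩
  mul_mem' := by
    rintro a b ⟨c, hc⟩ ⟨d, hd⟩
    refine ⟨d * c, ?_⟩
    rw [SL2C.val_mul, ← mulVec_mulVec, hd, mulVec_smul, hc, smul_smul]
  inv_mem' := by
    rintro a ⟨c, hc⟩
    have h : v = c • ((a⁻¹ : SL2C) : Matrix (Fin 2) (Fin 2) ℂ) *ᵥ v := by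
      rw [← mulVec_smul, ← hc, mulVec_mulVec, ← SL2C.val_mul, inv_mul_cancel,
        SL2C.val_one, one_mulVec]
    have hc0 : c ≠ 0 := by
      rintro rfl
      exact hv (by simpa using h)
    exact ⟨c⁻¹, by nth_rewrite 2 [h]; rw [smul_smul, inv_mul_cancel₀ hc0, one_smul]⟩

lemma exists_eigenvector (A : SL2C) (ζ : ℂ) (h : ζ ^ 2 - A.1.trace * ζ + 1 = 0) :
    ∃ v : Fin 2 → ℂ, v ≠ 0 ∧ A.1 *ᵥ v = ζ • v := by
  have hdet := A.2
  have : (A.1 - ζ • (1 : Matrix (Fin 2) (Fin 2) ℂ)).det = 0 := by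
    rw [det_fin_two] at hdet ⊢
    rw [trace_fin_two] at h
    simp
    linear_combination h + hdet
  obtain ⟨v, hv, h0⟩ := exists_mulVec_eq_zero_iff.2 this
  refine ⟨v, hv, ?_⟩
  rw [sub_mulVec, smul_mulVec, one_mulVec, sub_eq_zero] at h0
  exact h0

lemma exists_eigenvalue (A : SL2C) : ∃ ζ : ℂ, ζ ^ 2 - A.1.trace * ζ + 1 = 0 := by
  obtain ⟨s, hs⟩ := IsAlgClosed.exists_pow_nat_eq (A.1.trace ^ 2 - 4) (n := 2) (by norm_num)
  exact ⟨(A.1.trace + s) / 2, by linear_combination hs / 4⟩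

lemma eigenvalue_eq {A : SL2C} {ζ : ℂ} {v : Fin 2 → ℂ} (hv : v ≠ 0) (h : A.1 *ᵥ v = ζ • v) :
    ζ ^ 2 - A.1.trace * ζ + 1 = 0 := by
  have h0 : (A.1 - ζ • (1 : Matrix (Fin 2) (Fin 2) ℂ)).det = 0 :=
    exists_mulVec_eq_zero_iff.1 ⟨v, hv, by
      rw [sub_mulVec, smul_mulVec, one_mulVec, h, sub_self]⟩
  have hdet := A.2
  rw [det_fin_two] at hdet h0
  rw [trace_fin_two]
  simp at h0
  linear_combination h0 - hdet

lemma eigenvalue_pow_eq_one {A : SL2C} {ζ : ℂ} {v : Fin 2 → ℂ} (hv : v ≠ 0)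
    (h : A.1 *ᵥ v = ζ • v) {n : ℕ} (hA : A ^ n = 1) : ζ ^ n = 1 := by
  have key : ∀ k : ℕ, (A.1 ^ k) *ᵥ v = ζ ^ k • v := by
    intro k
    induction k with
    | zero => simp
    | succ k ih => rw [pow_succ', ← mulVec_mulVec, ih, mulVec_smul, h, smul_smul, pow_succ]
  have h1 := key n
  rw [← SL2C.val_pow, hA, SL2C.val_one, one_mulVec] at h1
  have h2 : (ζ ^ n - 1) • v = 0 := by rw [sub_smul, ← h1, one_smul, sub_self]
  exact sub_eq_zero.1 ((smul_eq_zero.1 h2).resolve_right hv)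

lemma sq_eq_trace_smul (A : SL2C) : A.1 * A.1 = A.1.trace • A.1 - 1 := by
  have hdet := A.2
  rw [det_fin_two] at hdet
  ext i j
  fin_cases i <;> fin_cases j <;> simp [mul_apply, trace_fin_two] <;>
    first | linear_combination -hdet | ring

lemma pow_eq_one_of_trace_mem {A : SL2C} {n : ℕ} (hn : 0 < n)
    (h : A.1.trace ∈ torsionTraces n) :
    A ^ n = 1 := by
  obtain ⟨ζ, h1, h2, ht⟩ := h
  have hζ : ζ ≠ 0 := by
    rintro rfl
    simp [hn.ne'] at h1
  have hA := sq_eq_trace_smul A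
  rw [ht] at hA
  have key : ∀ k : ℕ, (ζ - ζ⁻¹) • A.1 ^ k =
      ζ ^ k • (A.1 - ζ⁻¹ • (1 : Matrix (Fin 2) (Fin 2) ℂ)) -
        ζ⁻¹ ^ k • (A.1 - ζ • (1 : Matrix (Fin 2) (Fin 2) ℂ)) := by
    intro k
    induction k with
    | zero => simp; module
    | succ k ih =>
      rw [pow_succ, ← smul_mul_assoc, ih]
      simp only [sub_mul, smul_mul_assoc, one_mul, hA, smul_sub, smul_smul]
      have hinv : ζ * ζ⁻¹ = 1 := mul_inv_cancel₀ hζ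
      rw [pow_succ, pow_succ]
      match_scalars
      · ring
      · linear_combination (ζ ^ k - ζ⁻¹ ^ k) * hinv
  have h3 := key n
  rw [inv_pow, h1, inv_one] at h3
  have h4 : ζ - ζ⁻¹ ≠ 0 := by
    intro h
    field_simp at h
    exact h2 (by linear_combination h)
  apply Subtype.ext
  rw [SL2C.val_pow, SL2C.val_one]
  apply smul_right_injective _ h4
  simp only [h3]
  module

lemma trace_mem_torsionTraces {A : SL2C} {n : ℕ} (hn : 0 < n) (hA : A ^ n = 1)
    (hsc : ∀ c : ℂ, A.1 ≠ c • 1) : A.1.trace ∈ torsionTraces n := by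
  obtain ⟨ζ, hζ⟩ := exists_eigenvalue A
  obtain ⟨v, hv, hAv⟩ := exists_eigenvector A ζ hζ
  have hζ0 : ζ ≠ 0 := by
    rintro rfl
    simp at hζ
  have h1 := eigenvalue_pow_eq_one hv hAv hA
  have ht : A.1.trace = ζ + ζ⁻¹ := by
    field_simp
    linear_combination -hζ
  refine ⟨ζ, h1, fun h2 => ?_, ht⟩
  have hinv : ζ⁻¹ = ζ := by
    field_simp
    exact h2.symm
  have hs := sq_eq_trace_smul A
  rw [ht, hinv] at hs
  have key : ∀ k : ℕ, A.1 ^ k =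
      ζ ^ k • (1 + (k * ζ) • (A.1 - ζ • (1 : Matrix (Fin 2) (Fin 2) ℂ))) := by
    intro k
    induction k with
    | zero => simp
    | succ k ih =>
      rw [pow_succ, ih]
      simp only [sub_mul, add_mul, smul_mul_assoc, one_mul, hs, smul_sub, smul_add, smul_smul]
      match_scalars
      · linear_combination (-ζ ^ k) * h2
      · linear_combination (ζ ^ k * ζ * (k + 1)) * h2
  have h3 := key n
  rw [← SL2C.val_pow, hA, SL2C.val_one, h1, one_smul, left_eq_add] at h3
  have h4 : (n * ζ : ℂ) ≠ 0 := mul_ne_zero (by exact_mod_cast hn.ne') hζ0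
  exact hsc ζ (sub_eq_zero.1 ((smul_eq_zero.1 h3).resolve_left h4))

lemma SL2C.trace_inv (A : SL2C) : (A⁻¹).1.trace = A.1.trace := by
  have h : (A⁻¹).1 = A.1.adjugate := rfl
  rw [h, adjugate_fin_two, trace_fin_two, trace_fin_two]
  simp [add_comm]

lemma SL2C.trace_conj (P A : SL2C) : (P * A * P⁻¹).1.trace = A.1.trace := by
  rw [SL2C.val_mul, trace_mul_comm, ← SL2C.val_mul, ← mul_assoc, inv_mul_cancel, one_mul]

lemma eigenvector_of_mul_mul_eq_one {A B C : SL2C} (h : A * B * C = 1) {v : Fin 2 → ℂ}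
    (hv : v ≠ 0) {b c : ℂ} (hB : B.1 *ᵥ v = b • v) (hC : C.1 *ᵥ v = c • v) :
    A.1 *ᵥ v = (b * c)⁻¹ • v := by
  have h1 : v = (b * c) • A.1 *ᵥ v := by
    have h2 : (A * B * C).1 *ᵥ v = v := by rw [h, SL2C.val_one, one_mulVec]
    rw [SL2C.val_mul, SL2C.val_mul, ← mulVec_mulVec, ← mulVec_mulVec, hC, mulVec_smul, hB,
      smul_smul, mulVec_smul, mul_comm] at h2
    exact h2.symm
  have h0 : b * c ≠ 0 := by
    intro h0
    rw [h0, zero_smul] at h1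
    exact hv h1
  nth_rewrite 2 [h1]
  rw [smul_smul, inv_mul_cancel₀ h0, one_smul]

/-- Two matrices have no common eigenvector. -/
def NoCommonEigenvector (A B : SL2C) : Prop :=
  ∀ v : Fin 2 → ℂ, v ≠ 0 → ∀ a b : ℂ, A.1 *ᵥ v = a • v → B.1 *ᵥ v = b • v → False

lemma NoCommonEigenvector.nonscalar_left {A B : SL2C} (h : NoCommonEigenvector A B) (c : ℂ) :
    A.1 ≠ c • 1 := by
  intro hA
  obtain ⟨ζ, hζ⟩ := exists_eigenvalue B
  obtain ⟨v, hv, hBv⟩ := exists_eigenvector B ζ hζ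
  exact h v hv c ζ (by rw [hA, smul_mulVec, one_mulVec]) hBv

lemma NoCommonEigenvector.symm {A B : SL2C} (h : NoCommonEigenvector A B) :
    NoCommonEigenvector B A :=
  fun v hv a b ha hb => h v hv b a hb ha

lemma NoCommonEigenvector.nonscalar_of_mul_mul_eq_one {A B C : SL2C}
    (h : NoCommonEigenvector A B) (habc : A * B * C = 1) (c : ℂ) : C.1 ≠ c • 1 := by
  intro hC
  obtain ⟨ζ, hζ⟩ := exists_eigenvalue B
  obtain ⟨v, hv, hBv⟩ := exists_eigenvector B ζ hζ
  have hCv : C.1 *ᵥ v = c • v := by rw [hC, smul_mulVec, one_mulVec]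
  exact h v hv _ ζ (eigenvector_of_mul_mul_eq_one habc hv hBv hCv) hBv

/-- A pair of matrices without common eigenvector has a normal form which depends only on an
eigenvalue of the first matrix and on the traces. -/
lemma NoCommonEigenvector.exists_normalForm {A B : SL2C} (h : NoCommonEigenvector A B) {ζ : ℂ}
    (hζ : ζ ^ 2 - A.1.trace * ζ + 1 = 0) :
    ∃ P : SL2C,
      (P⁻¹ * A * P).1 = !![ζ, (A * B).1.trace - (A.1.trace - ζ) * B.1.trace; 0, A.1.trace - ζ] ∧
      (P⁻¹ * B * P).1 = !![0, -1; 1, B.1.trace] := by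
  obtain ⟨v, hv, hAv⟩ := exists_eigenvector A ζ hζ
  set w := B.1 *ᵥ v with hw
  have hd : v 0 * w 1 - v 1 * w 0 ≠ 0 := by
    intro hd
    by_cases h0 : v 0 = 0
    · have h1 : v 1 ≠ 0 := by
        intro h1
        apply hv
        ext i
        fin_cases i <;> simp [h0, h1]
      refine h v hv ζ (w 1 / v 1) hAv ?_
      rw [← hw]
      ext i
      fin_cases i
      · simp [h0, h1] at hd
        simp [h0, hd]
      · simp [h1]
    · refine h v hv ζ (w 0 / v 0) hAv ?_
      rw [← hw]
      ext i
      fin_cases i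
      · simp [h0]
      · simp
        field_simp
        linear_combination hd
  obtain ⟨s, hs⟩ := IsAlgClosed.exists_pow_nat_eq (v 0 * w 1 - v 1 * w 0)⁻¹ (n := 2) (by norm_num)
  let P : SL2C := ⟨!![s * v 0, s * w 0; s * v 1, s * w 1], by
    rw [det_fin_two_of]
    have : s ^ 2 * (v 0 * w 1 - v 1 * w 0) = 1 := by rw [hs, inv_mul_cancel₀ hd]
    linear_combination this⟩
  have hP0 : P.1 *ᵥ ![1, 0] = s • v := by
    ext i
    fin_cases i <;> simp [P, mulVec, dotProduct]
  have hP1 : P.1 *ᵥ ![0, 1] = s • w := by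
    ext i
    fin_cases i <;> simp [P, mulVec, dotProduct]
  have hinv : ∀ u : Fin 2 → ℂ, (P⁻¹).1 *ᵥ (P.1 *ᵥ u) = u := by
    intro u
    rw [mulVec_mulVec, ← SL2C.val_mul, inv_mul_cancel, SL2C.val_one, one_mulVec]
  have hA0 : (P⁻¹ * A * P).1 *ᵥ ![1, 0] = ζ • ![1, 0] := by
    rw [SL2C.val_mul, SL2C.val_mul, ← mulVec_mulVec, ← mulVec_mulVec, hP0, mulVec_smul, hAv,
      smul_comm, mulVec_smul, ← hP0, hinv]
  have hB0 : (P⁻¹ * B * P).1 *ᵥ ![1, 0] = ![0, 1] := by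
    rw [SL2C.val_mul, SL2C.val_mul, ← mulVec_mulVec, ← mulVec_mulVec, hP0, mulVec_smul, ← hw,
      ← hP1, hinv]
  have hAt := SL2C.trace_conj P⁻¹ A
  have hBt := SL2C.trace_conj P⁻¹ B
  have hABt := SL2C.trace_conj P⁻¹ (A * B)
  have hAB : P⁻¹ * (A * B) * P = (P⁻¹ * A * P) * (P⁻¹ * B * P) := by group
  rw [inv_inv] at hAt hBt hABt
  rw [hAB, SL2C.val_mul] at hABt
  refine ⟨P, ?_⟩
  rw [← hABt, ← hAt, ← hBt]
  generalize P⁻¹ * A * P = M at *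
  generalize P⁻¹ * B * P = N at *
  have hN := N.2
  have hA00 := congrFun hA0 0
  have hA01 := congrFun hA0 1
  have hB00 := congrFun hB0 0
  have hB01 := congrFun hB0 1
  rw [det_fin_two] at hN
  simp [mulVec, dotProduct] at hA00 hA01 hB00 hB01
  rw [hB00, hB01] at hN
  constructor
  · ext i j
    fin_cases i <;> fin_cases j <;>
      simp [trace_fin_two, mul_apply, hA00, hA01, hB00, hB01]
  · ext i j
    fin_cases i <;> fin_cases j <;> simp [trace_fin_two, hB00, hB01]
    linear_combination -hN

section TriangleGroup

variable {a b c : ℕ}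

lemma triangle_relations (ρ : PresentedGroup (triangleRels a b c) →* SL2C) :
    ρ (.of 0) ^ a = 1 ∧ ρ (.of 1) ^ b = 1 ∧ ρ (.of 2) ^ c = 1 ∧
      ρ (.of 0) * ρ (.of 1) * ρ (.of 2) = 1 := by
  have key : ∀ w ∈ triangleRels a b c, ρ (PresentedGroup.mk _ w) = 1 := fun w hw => by
    rw [PresentedGroup.one_of_mem hw, map_one]
  refine ⟨?_, ?_, ?_, ?_⟩
  · have h := key (FreeGroup.of 0 ^ a) (by simp [triangleRels])
    simp only [map_pow] at h
    exact h
  · have h := key (FreeGroup.of 1 ^ b) (by simp [triangleRels])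
    simp only [map_pow] at h
    exact h
  · have h := key (FreeGroup.of 2 ^ c) (by simp [triangleRels])
    simp only [map_pow] at h
    exact h
  · have h := key (FreeGroup.of 0 * FreeGroup.of 1 * FreeGroup.of 2) (by simp [triangleRels])
    simp only [map_mul] at h
    exact h

lemma isIrreducibleRep_iff (ρ : PresentedGroup (triangleRels a b c) →* SL2C) :
    IsIrreducibleRep ρ ↔ NoCommonEigenvector (ρ (.of 0)) (ρ (.of 1)) := by
  constructor
  · intro h v hv s t hs ht
    refine h ⟨v, hv, ?_⟩
    have h0 : ρ (.of 0) ∈ lineStabilizer v hv := ⟨s, hs⟩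
    have h1 : ρ (.of 1) ∈ lineStabilizer v hv := ⟨t, ht⟩
    have h2 : ρ (.of 2) ∈ lineStabilizer v hv := by
      rw [← inv_eq_of_mul_eq_one_right (triangle_relations ρ).2.2.2]
      exact inv_mem (mul_mem h0 h1)
    intro g
    refine PresentedGroup.generated_by _ ((lineStabilizer v hv).comap ρ) (fun j => ?_) g
    fin_cases j
    exacts [h0, h1, h2]
  · rintro h ⟨v, hv, hg⟩
    obtain ⟨s, hs⟩ := hg (.of 0)
    obtain ⟨t, ht⟩ := hg (.of 1)
    exact h v hv s t hs ht

/-- The traces of the images of the three generators of a triangle group. -/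
def generatorTraces (ρ : PresentedGroup (triangleRels a b c) →* SL2C) : ℂ × ℂ × ℂ :=
  ((ρ (.of 0)).1.trace, (ρ (.of 1)).1.trace, (ρ (.of 2)).1.trace)

lemma generatorTraces_eq_of_conjRel
    {ρ₁ ρ₂ : {ρ : PresentedGroup (triangleRels a b c) →* SL2C // IsIrreducibleRep ρ}}
    (h : ConjRel ρ₁ ρ₂) : generatorTraces ρ₁.1 = generatorTraces ρ₂.1 := by
  obtain ⟨P, hP⟩ := h
  simp only [generatorTraces, hP, SL2C.trace_conj]

lemma conjRel_of_generatorTraces_eq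
    {ρ₁ ρ₂ : {ρ : PresentedGroup (triangleRels a b c) →* SL2C // IsIrreducibleRep ρ}}
    (h : generatorTraces ρ₁.1 = generatorTraces ρ₂.1) : ConjRel ρ₁ ρ₂ := by
  simp only [generatorTraces, Prod.mk.injEq] at h
  obtain ⟨hx, hy, hz⟩ := h
  have hz₁ := inv_eq_of_mul_eq_one_right (triangle_relations ρ₁.1).2.2.2
  have hz₂ := inv_eq_of_mul_eq_one_right (triangle_relations ρ₂.1).2.2.2
  rw [← hz₁, ← hz₂, SL2C.trace_inv, SL2C.trace_inv] at hz
  obtain ⟨ζ, hζ⟩ := exists_eigenvalue (ρ₁.1 (.of 0))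
  obtain ⟨P₁, hA₁, hB₁⟩ := ((isIrreducibleRep_iff _).1 ρ₁.2).exists_normalForm hζ
  rw [hx] at hζ
  obtain ⟨P₂, hA₂, hB₂⟩ := ((isIrreducibleRep_iff _).1 ρ₂.2).exists_normalForm hζ
  have hA : P₁⁻¹ * ρ₁.1 (.of 0) * P₁ = P₂⁻¹ * ρ₂.1 (.of 0) * P₂ :=
    Subtype.ext (by rw [hA₁, hA₂, hx, hy, hz])
  have hB : P₁⁻¹ * ρ₁.1 (.of 1) * P₁ = P₂⁻¹ * ρ₂.1 (.of 1) * P₂ :=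
    Subtype.ext (by rw [hB₁, hB₂, hy])
  have conj : ∀ g h : SL2C, P₁⁻¹ * g * P₁ = P₂⁻¹ * h * P₂ →
      h = MulAut.conj (P₂ * P₁⁻¹) g := by
    intro g h hgh
    have h1 : h = P₂ * (P₂⁻¹ * h * P₂) * P₂⁻¹ := by group
    rw [h1, ← hgh, MulAut.conj_apply]
    group
  refine ⟨P₂ * P₁⁻¹, fun g => ?_⟩
  have hext : ρ₂.1 = (MulAut.conj (P₂ * P₁⁻¹)).toMonoidHom.comp ρ₁.1 := by
    apply PresentedGroup.ext
    intro j
    fin_cases j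
    · exact conj _ _ hA
    · exact conj _ _ hB
    · change ρ₂.1 (.of 2) = MulAut.conj (P₂ * P₁⁻¹) (ρ₁.1 (.of 2))
      rw [← hz₁, ← hz₂, conj _ _ hA, conj _ _ hB, ← map_mul (MulAut.conj (P₂ * P₁⁻¹)), map_inv]
  rw [hext]
  rfl

lemma generatorTraces_mem (ha : 0 < a) (hb : 0 < b) (hc : 0 < c)
    {ρ : PresentedGroup (triangleRels a b c) →* SL2C} (hρ : IsIrreducibleRep ρ) :
    generatorTraces ρ ∈ torsionTraces a ×ˢ torsionTraces b ×ˢ torsionTraces c := by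
  obtain ⟨h0, h1, h2, h3⟩ := triangle_relations ρ
  rw [isIrreducibleRep_iff] at hρ
  exact ⟨trace_mem_torsionTraces ha h0 hρ.nonscalar_left,
    trace_mem_torsionTraces hb h1 hρ.symm.nonscalar_left,
    trace_mem_torsionTraces hc h2 (hρ.nonscalar_of_mul_mul_eq_one h3)⟩

lemma exists_rep_of_torsionTraces (ha : 0 < a) (hb : 0 < b) (hc : 0 < c)
    (hac : Nat.Coprime a c) (hbc : Nat.Coprime b c) {t : ℂ × ℂ × ℂ}
    (ht : t ∈ torsionTraces a ×ˢ torsionTraces b ×ˢ torsionTraces c) :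
    ∃ ρ : PresentedGroup (triangleRels a b c) →* SL2C,
      IsIrreducibleRep ρ ∧ generatorTraces ρ = t := by
  obtain ⟨t₁, t₂, t₃⟩ := t
  obtain ⟨h₁, h₂, h₃⟩ := ht
  dsimp only at h₁ h₂ h₃
  obtain ⟨ζ, hζa, -, ht₁⟩ := id h₁
  have hζ : ζ ≠ 0 := by
    rintro rfl
    simp [ha.ne'] at hζa
  let A : SL2C := ⟨!![ζ, t₃ - ζ⁻¹ * t₂; 0, ζ⁻¹], by rw [det_fin_two_of]; field_simp; ring⟩
  let B : SL2C := ⟨!![0, -1; 1, t₂], by rw [det_fin_two_of]; ring⟩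
  have hAt : A.1.trace = t₁ := by rw [ht₁, trace_fin_two]; simp [A]
  have hBt : B.1.trace = t₂ := by rw [trace_fin_two]; simp [B]
  have hCt : ((A * B)⁻¹).1.trace = t₃ := by
    rw [SL2C.trace_inv, SL2C.val_mul, trace_fin_two]
    simp [A, B, mul_apply]
  have hA : A ^ a = 1 := pow_eq_one_of_trace_mem ha (hAt ▸ h₁)
  have hB : B ^ b = 1 := pow_eq_one_of_trace_mem hb (hBt ▸ h₂)
  have hC : (A * B)⁻¹ ^ c = 1 := pow_eq_one_of_trace_mem hc (hCt.symm ▸ h₃)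
  let f : Fin 3 → SL2C := ![A, B, (A * B)⁻¹]
  have hf : ∀ w ∈ triangleRels a b c, FreeGroup.lift f w = 1 := by
    rintro w (rfl | rfl | rfl | rfl)
    · simpa [f] using hA
    · simpa [f] using hB
    · simp only [map_pow, FreeGroup.lift_apply_of]
      exact hC
    · simp only [map_mul, FreeGroup.lift_apply_of]
      exact mul_inv_cancel (A * B)
  let ρ := PresentedGroup.toGroup hf
  have hρ0 : ρ (.of 0) = A := PresentedGroup.toGroup.of hf
  have hρ1 : ρ (.of 1) = B := PresentedGroup.toGroup.of hf
  have hρ2 : ρ (.of 2) = (A * B)⁻¹ := PresentedGroup.toGroup.of hf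
  refine ⟨ρ, ?_, by simp only [generatorTraces, hρ0, hρ1, hρ2, hAt, hBt, hCt]⟩
  rw [isIrreducibleRep_iff, hρ0, hρ1]
  intro v hv x y hx hy
  have hx1 := eigenvalue_pow_eq_one hv hx hA
  have hy1 := eigenvalue_pow_eq_one hv hy hB
  have hz : ((A * B)⁻¹).1 *ᵥ v = (x * y)⁻¹ • v :=
    eigenvector_of_mul_mul_eq_one (by group) hv hx hy
  have hz1 := eigenvalue_pow_eq_one hv hz hC
  have hz2 : (x * y)⁻¹ ^ (a * b) = 1 := by
    rw [inv_pow, mul_pow, pow_mul, hx1, mul_comm a b, pow_mul, hy1]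
    simp
  have hone : (x * y)⁻¹ = 1 := by
    have := pow_gcd_eq_one.2 ⟨hz2, hz1⟩
    rwa [(Nat.Coprime.mul_left hac hbc).gcd_eq_one, pow_one] at this
  have heig := eigenvalue_eq hv hz
  obtain ⟨ξ, hξ1, hξ2, hξ⟩ := h₃
  have hξ0 : ξ ≠ 0 := by
    rintro rfl
    simp [hc.ne'] at hξ1
  rw [hone, hCt, hξ] at heig
  field_simp at heig
  have hsq : (ξ - 1) ^ 2 = 0 := by linear_combination -heig
  have : ξ = 1 := sub_eq_zero.1 (pow_eq_zero_iff two_ne_zero |>.1 hsq)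
  simp [this] at hξ2

end TriangleGroup

/-- The set of conjugacy classes of irreducible `SL₂(ℂ)` representations of the
triangle group `T(2p,q,r)` is finite of cardinality `(p-1)·((q-1)/2)·((r-1)/2)`. -/
theorem triangle_card_irreducible_conj_classes
    (p q r : ℕ) (hp : 0 < p) (hq : 0 < q) (hr : 0 < r)
    (hqodd : Odd q) (hrodd : Odd r)
    (hpq : Nat.Coprime p q) (hpr : Nat.Coprime p r) (hqr : Nat.Coprime q r) :
    Finite (Quot (ConjRel (G := PresentedGroup (triangleRels (2 * p) q r)))) ∧
      Nat.card (Quot (ConjRel (G := PresentedGroup (triangleRels (2 * p) q r)))) =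
        (p - 1) * ((q - 1) / 2) * ((r - 1) / 2) := by
  have ha : 0 < 2 * p := by omega
  have har : Nat.Coprime (2 * p) r :=
    Nat.Coprime.mul_left (Nat.coprime_two_left.2 hrodd) hpr
  obtain ⟨fin₁, card₁⟩ := ncard_torsionTraces ha
  obtain ⟨fin₂, card₂⟩ := ncard_torsionTraces hq
  obtain ⟨fin₃, card₃⟩ := ncard_torsionTraces hr
  let F : Quot (ConjRel (G := PresentedGroup (triangleRels (2 * p) q r))) → ℂ × ℂ × ℂ :=
    Quot.lift (fun ρ => generatorTraces ρ.1) fun _ _ => generatorTraces_eq_of_conjRel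
  have hF : Function.Injective F := by
    rintro ⟨ρ₁⟩ ⟨ρ₂⟩ h
    exact Quot.sound (conjRel_of_generatorTraces_eq h)
  have hrange : Set.range F = torsionTraces (2 * p) ×ˢ torsionTraces q ×ˢ torsionTraces r := by
    ext t
    constructor
    · rintro ⟨⟨ρ⟩, rfl⟩
      exact generatorTraces_mem ha hq hr ρ.2
    · intro ht
      obtain ⟨ρ, hρ, h⟩ := exists_rep_of_torsionTraces ha hq hr har hqr ht
      exact ⟨Quot.mk _ ⟨ρ, hρ⟩, h⟩
  refine ⟨(Set.finite_range_iff hF).1 (hrange ▸ fin₁.prod (fin₂.prod fin₃)), ?_⟩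
  rw [← Nat.card_range_of_injective hF, Nat.card_coe_set_eq, hrange, Set.ncard_prod,
    Set.ncard_prod, card₁, card₂, card₃, ← mul_assoc]
  congr 2
  omega
end
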